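/- arXiv:1705.01954 — 2 statements merged into one kernel-verified Lean document; each statement's English description precedes it below -/
import Mathlib

section
/- Exp⁻ is the orthogonal complement of Exp⁺ in H; consequently H decomposes as the internal orthogonal direct sum H = Exp⁺ ⊕ Exp⁻. -/
open MeasureTheory Complex

noncomputable section

instance : Fact ((0 : ℝ) < 2 * Real.pi) := ⟨by positivity⟩

/-- The Hilbert space `H = L²(S¹;ℂ) × L²(S¹;ℂ) = L²(S¹;ℂ²)`, `S¹ = ℝ/2πℤ`. -/
abbrev Hcirc : Type :=
  WithLp 2 (Lp ℂ 2 (@AddCircle.haarAddCircle (2 * Real.pi) _) ×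
    Lp ℂ 2 (@AddCircle.haarAddCircle (2 * Real.pi) _))

/-- `sgn(l) = 1` for `l ≥ 0` and `−1` for `l < 0`, as a complex number. -/
def sgn (l : ℤ) : ℂ := if 0 ≤ l then 1 else -1

/-- `Exp⁺`: closure of the span of `{(e_l, −i·sgn(l)·e_l) : l ∈ ℤ}`. -/
def ExpPlus : Submodule ℂ Hcirc :=
  (Submodule.span ℂ (Set.range fun l : ℤ =>
    ((WithLp.equiv 2 _).symm (fourierLp 2 l, (-I * sgn l) • fourierLp 2 l) : Hcirc))).topologicalClosure

/-- `Exp⁻`: closure of the span of `{(e_l, i·sgn(l)·e_l) : l ∈ ℤ}`. -/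
def ExpMinus : Submodule ℂ Hcirc :=
  (Submodule.span ℂ (Set.range fun l : ℤ =>
    ((WithLp.equiv 2 _).symm (fourierLp 2 l, (I * sgn l) • fourierLp 2 l) : Hcirc))).topologicalClosure

end

lemma sgn_mul_conj (l : ℤ) : sgn l * (starRingEnd ℂ) (sgn l) = 1 := by
  unfold sgn; split_ifs <;> simp

lemma sgn_ne_zero' (l : ℤ) : sgn l ≠ 0 := by
  unfold sgn; split_ifs <;> simp

lemma mem_orth_closure_span {ι : Type*} (f : ι → Hcirc) (x : Hcirc) :
    x ∈ (Submodule.span ℂ (Set.range f)).topologicalClosureᗮ ↔ ∀ l, inner ℂ (f l) x = 0 := by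
  rw [Submodule.orthogonal_closure]
  constructor
  · intro h l
    exact (Submodule.mem_orthogonal _ _).1 h _ (Submodule.subset_span ⟨l, rfl⟩)
  · intro h
    rw [Submodule.mem_orthogonal]
    intro u hu
    induction hu using Submodule.span_induction with
    | mem u hu => obtain ⟨l, rfl⟩ := hu; exact h l
    | zero => simp
    | add a b _ _ ha hb => rw [inner_add_left, ha, hb, add_zero]
    | smul c a _ ha => rw [inner_smul_left, ha, mul_zero]

lemma expMinus_le : ExpMinus ≤ ExpPlusᗮ := by
  unfold ExpMinus
  refine Submodule.topologicalClosure_minimal _ ?_ (Submodule.isClosed_orthogonal _)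
  rw [Submodule.span_le]
  rintro _ ⟨m, rfl⟩
  unfold ExpPlus
  rw [SetLike.mem_coe, mem_orth_closure_span]
  intro l
  have ho := (orthonormal_iff_ite.1 (@orthonormal_fourier (2 * Real.pi) _)) l m
  simp only [WithLp.prod_inner_apply, WithLp.equiv_symm_apply, inner_smul_left, inner_smul_right,
    ho]
  split_ifs with h
  · subst h
    have := sgn_mul_conj l
    simp only [map_mul, map_neg, conj_I]
    linear_combination (I * I) * this + I_mul_I
  · simp

lemma inf_orth : ExpMinusᗮ ⊓ ExpPlusᗮ = ⊥ := by
  rw [eq_bot_iff]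
  rintro x ⟨h1, h2⟩
  unfold ExpMinus at h1
  unfold ExpPlus at h2
  rw [SetLike.mem_coe, mem_orth_closure_span] at h1 h2
  simp only [WithLp.prod_inner_apply, WithLp.equiv_symm_apply, inner_smul_left] at h1 h2
  have hz : ∀ y : Lp ℂ 2 (@AddCircle.haarAddCircle (2 * Real.pi) _),
      (∀ l : ℤ, inner ℂ (fourierLp 2 l) y = 0) → y = 0 := by
    intro y hy
    apply (@fourierBasis (2 * Real.pi) _).repr.injective
    ext l
    rw [HilbertBasis.repr_apply_apply, coe_fourierBasis, hy]
    simp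
  have ha : x.ofLp.1 = 0 := hz _ fun l => by
    have a := h1 l
    have b := h2 l
    simp only [map_mul, map_neg, conj_I] at a b
    linear_combination (a + b) / 2
  have hb : x.ofLp.2 = 0 := hz _ fun l => by
    have a := h1 l
    simp only [map_mul, conj_I] at a
    have hc : (starRingEnd ℂ) (sgn l) ≠ 0 := by
      simpa using sgn_ne_zero' l
    rw [ha, inner_zero_right, zero_add] at a
    simpa [hc] using a
  rw [Submodule.mem_bot]
  apply (WithLp.equiv 2 _).injective
  exact Prod.ext ha hb

/-- `Exp⁻` is the orthogonal complement of `Exp⁺` in `H = L²(S¹;ℂ²)`, and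
consequently `H` decomposes as the internal orthogonal direct sum `H = Exp⁺ ⊕ Exp⁻`
(the decomposition of Section 2.1 of the paper). -/
theorem expMinus_eq_orthogonal_expPlus :
    ExpMinus = ExpPlusᗮ ∧ ExpPlus ⊓ ExpMinus = ⊥ ∧ ExpPlus ⊔ ExpMinus = ⊤ := by
  have hcp : IsClosed (ExpPlus : Set Hcirc) := Submodule.isClosed_topologicalClosure _
  have hcm : IsClosed (ExpMinus : Set Hcirc) := Submodule.isClosed_topologicalClosure _
  haveI : CompleteSpace ExpPlus := hcp.completeSpace_coe
  haveI : CompleteSpace ExpMinus := hcm.completeSpace_coe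
  have h : ExpMinus = ExpPlusᗮ := by
    have := Submodule.sup_orthogonal_inf_of_hasOrthogonalProjection expMinus_le
    rwa [inf_orth, sup_bot_eq] at this
  refine ⟨h, ?_, ?_⟩
  · rw [h]; exact Submodule.inf_orthogonal_eq_bot _
  · rw [h]; exact Submodule.sup_orthogonal_of_hasOrthogonalProjection
end

section
/- Let p ≥ 0, a ≥ 0 and r > 0. Then 𝔍_{p,a}(r) ≤ (r^p / (2^p · Γ(p+1))) · e^{a r}. -/
/-- The modified Bessel-type function `𝔍_{p,a}` of equation (4.4) of the paper:
`𝔍_{p,a}(r) = Σ_{n=0}^∞ a^{2n} r^{2n+p} / (2^{2n+p} · n! · Γ(n+p+1))`. -/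
noncomputable def besselJ (p a r : ℝ) : ℝ :=
  ∑' n : ℕ, a ^ (2 * n) * r ^ ((2 * n : ℝ) + p) /
    ((2 : ℝ) ^ ((2 * n : ℝ) + p) * (n.factorial : ℝ) * Real.Gamma ((n : ℝ) + p + 1))

theorem bj_gamma (p : ℝ) (hp : 0 ≤ p) (n : ℕ) :
    (n.factorial : ℝ) * Real.Gamma (p + 1) ≤ Real.Gamma ((n : ℝ) + p + 1) := by
  induction n with
  | zero => simp
  | succ k ih =>
    have hk : (0 : ℝ) < (k : ℝ) + p + 1 := by positivity
    have e : ((k + 1 : ℕ) : ℝ) + p + 1 = ((k : ℝ) + p + 1) + 1 := by push_cast; ring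
    rw [e, Real.Gamma_add_one hk.ne', Nat.factorial_succ]
    push_cast
    rw [mul_assoc]
    have hG : 0 < Real.Gamma (p + 1) := Real.Gamma_pos_of_pos (by positivity)
    apply mul_le_mul _ ih (by positivity) hk.le
    linarith

theorem bj_fact (n : ℕ) :
    ((2 * n).factorial : ℝ) ≤ 4 ^ n * (n.factorial : ℝ) * (n.factorial : ℝ) := by
  induction n with
  | zero => simp
  | succ k ih =>
    have e : 2 * (k + 1) = 2 * k + 1 + 1 := by ring
    rw [e, Nat.factorial_succ, Nat.factorial_succ, Nat.factorial_succ]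
    push_cast
    calc (2 * (k : ℝ) + 1 + 1) * ((2 * k + 1) * ((2 * k).factorial : ℝ))
        ≤ (2 * (k : ℝ) + 1 + 1) * ((2 * k + 1 + 1) * (4 ^ k * (k.factorial : ℝ) * k.factorial)) := by
          gcongr
          linarith
      _ = _ := by ring

theorem bj_term (p : ℝ) (hp : 0 ≤ p) (a : ℝ) (ha : 0 ≤ a) (r : ℝ) (hr : 0 < r) (n : ℕ) :
    a ^ (2 * n) * r ^ ((2 * n : ℝ) + p) /
    ((2 : ℝ) ^ ((2 * n : ℝ) + p) * (n.factorial : ℝ) * Real.Gamma ((n : ℝ) + p + 1)) ≤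
    r ^ p / ((2 : ℝ) ^ p * Real.Gamma (p + 1)) * ((a * r) ^ (2 * n) / ((2 * n).factorial : ℝ)) := by
  have hG : 0 < Real.Gamma (p + 1) := Real.Gamma_pos_of_pos (by positivity)
  have e : (2 * n : ℝ) = ((2 * n : ℕ) : ℝ) := by push_cast; ring
  have h4 : (2 : ℝ) ^ (2 * n) = 4 ^ n := by rw [pow_mul]; norm_num
  rw [e, Real.rpow_add hr, Real.rpow_add two_pos, Real.rpow_natCast, Real.rpow_natCast, h4,
    div_mul_div_comm, mul_pow]
  have hrp : 0 < r ^ p := Real.rpow_pos_of_pos hr p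
  have h2p : 0 < (2 : ℝ) ^ p := Real.rpow_pos_of_pos two_pos p
  have e2 : a ^ (2 * n) * (r ^ (2 * n) * r ^ p) = r ^ p * (a ^ (2 * n) * r ^ (2 * n)) := by ring
  rw [e2]
  apply div_le_div_of_nonneg_left (by positivity) (by positivity)
  calc 2 ^ p * Real.Gamma (p + 1) * ((2 * n).factorial : ℝ)
      ≤ 2 ^ p * Real.Gamma (p + 1) * (4 ^ n * (n.factorial : ℝ) * (n.factorial : ℝ)) := by
        gcongr
        exact bj_fact n
    _ = 4 ^ n * 2 ^ p * (n.factorial : ℝ) * ((n.factorial : ℝ) * Real.Gamma (p + 1)) := by ring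
    _ ≤ _ := by
        gcongr
        exact bj_gamma p hp n

/-- for `p ≥ 0`, `a ≥ 0` and `r > 0`, the exponential growth bound
`𝔍_{p,a}(r) ≤ (r^p/(2^p·Γ(p+1)))·e^{ar}` holds (used in Proposition 4.2 of the paper). -/
theorem besselJ_le_exp (p : ℝ) (hp : 0 ≤ p) (a : ℝ) (ha : 0 ≤ a) (r : ℝ) (hr : 0 < r) :
    besselJ p a r ≤ r ^ p / ((2 : ℝ) ^ p * Real.Gamma (p + 1)) * Real.exp (a * r) := by
  have hG : 0 < Real.Gamma (p + 1) := Real.Gamma_pos_of_pos (by positivity)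
  have hS := (Real.hasSum_cosh (a * r)).mul_left (r ^ p / ((2 : ℝ) ^ p * Real.Gamma (p + 1)))
  have hs : Summable fun n : ℕ => a ^ (2 * n) * r ^ ((2 * n : ℝ) + p) /
      ((2 : ℝ) ^ ((2 * n : ℝ) + p) * (n.factorial : ℝ) * Real.Gamma ((n : ℝ) + p + 1)) := by
    refine Summable.of_nonneg_of_le (fun n => ?_) (bj_term p hp a ha r hr) hS.summable
    have : 0 < Real.Gamma ((n : ℝ) + p + 1) := Real.Gamma_pos_of_pos (by positivity)
    positivity
  refine (hs.tsum_le_tsum (bj_term p hp a ha r hr) hS.summable).trans ?_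
  rw [hS.tsum_eq]
  gcongr
  rw [Real.cosh_eq]
  have : Real.exp (-(a * r)) ≤ Real.exp (a * r) := by
    apply Real.exp_le_exp.mpr
    have : 0 ≤ a * r := by positivity
    linarith
  linarith
end
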